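/- With m_r(n) the r-th central moment of the Gepner statistic over W(n,n,n), the standardized even moments have the following limits as n → ∞: m_6(n)/m_2(n)³ → 279/7, m_8(n)/m_2(n)⁴ → 3429/5, m_10(n)/m_2(n)⁵ → 206955/11, and m_12(n)/m_2(n)⁶ → 343717911/455. -/

import Mathlib

/-- The Gepner statistic of a word `w` over a totally ordered alphabet:
the number of triples of positions `i < j < k` such that `w_i w_j w_k`
reduces to one of the odd permutations `132`, `213`, `321`. -/
def gep {α : Type*} [LinearOrder α] (w : List α) : ℕ :=
  (Finset.univ.filter (fun t : Fin w.length × Fin w.length × Fin w.length =>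
    t.1 < t.2.1 ∧ t.2.1 < t.2.2 ∧
      ((w.get t.1 < w.get t.2.2 ∧ w.get t.2.2 < w.get t.2.1) ∨
       (w.get t.2.1 < w.get t.1 ∧ w.get t.1 < w.get t.2.2) ∨
       (w.get t.2.2 < w.get t.2.1 ∧ w.get t.2.1 < w.get t.1)))).card

/-- `W a1 a2 a3` is the (finite) set of words over the alphabet `{1,2,3}`
with exactly `a1` occurrences of `1`, `a2` occurrences of `2` and
`a3` occurrences of `3`. -/
def W (a1 a2 a3 : ℕ) : Finset (List ℕ) :=
  ((List.replicate a1 1 ++ List.replicate a2 2 ++ List.replicate a3 3).permutations).toFinset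
/-- The `r`-th central moment of the Gepner statistic over `W(n,n,n)`,
i.e. `(1/|W(n,n,n)|) ∑_{w ∈ W(n,n,n)} (gep(w) − n³/2)^r`, viewed as a
real number. -/
noncomputable def m (r n : ℕ) : ℝ :=
  (∑ w ∈ W n n n, ((gep w : ℝ) - (n : ℝ) ^ 3 / 2) ^ r) / ((W n n n).card : ℝ)


namespace Gp
open Finset

abbrev Fn := (Fin 3 → ℝ) → ℝ

/-- shift by a unit vector -/
def T (i : Fin 3) (f : Fn) : Fn := fun x => f (x - Pi.single i 1)
/-- difference operator -/
def Df (i : Fin 3) (f : Fn) : Fn := f - T i f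
def X (i : Fin 3) : Fn := fun x => x i
def N : Fn := X 0 + X 1 + X 2
def El (i : Fin 3) : Fn := (3 : ℝ) • X i - N
def L (f : Fn) : Fn := ∑ i, X i * Df i f

def G (d w : ℤ) : Submodule ℝ Fn :=
  Submodule.span ℝ {f | ∃ i j k : ℕ, (i + j + k : ℤ) ≤ d ∧ (2 * i + j + k : ℤ) ≤ w ∧
    f = N ^ i * El 0 ^ j * El 1 ^ k}

lemma G_mono {d d' w w' : ℤ} {f : Fn} (hf : f ∈ G d w) (h1 : d ≤ d') (h2 : w ≤ w') :
    f ∈ G d' w' := by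
  refine Submodule.span_mono ?_ hf
  rintro f ⟨i, j, k, a, b, rfl⟩
  exact ⟨i, j, k, a.trans h1, b.trans h2, rfl⟩

lemma G_mul {d d' w w' : ℤ} {f g : Fn} (hf : f ∈ G d w) (hg : g ∈ G d' w') :
    f * g ∈ G (d + d') (w + w') := by
  have := Submodule.mul_mem_mul hf hg
  unfold G at this
  rw [Submodule.span_mul_span] at this
  refine Submodule.span_mono ?_ this
  rintro _ ⟨_, ⟨i, j, k, a, b, rfl⟩, _, ⟨i', j', k', a', b', rfl⟩, rfl⟩
  refine ⟨i + i', j + j', k + k', by push_cast; linarith, by push_cast; linarith, ?_⟩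
  simp only
  ring

lemma N_mem : N ∈ G 1 2 := Submodule.subset_span ⟨1, 0, 0, by norm_num, by norm_num, by simp⟩
lemma one_mem : (1 : Fn) ∈ G 0 0 :=
  Submodule.subset_span ⟨0, 0, 0, by norm_num, by norm_num, by simp⟩
lemma El0_mem : El 0 ∈ G 1 1 := Submodule.subset_span ⟨0, 1, 0, by norm_num, by norm_num, by simp⟩
lemma El1_mem : El 1 ∈ G 1 1 := Submodule.subset_span ⟨0, 0, 1, by norm_num, by norm_num, by simp⟩
lemma El2_eq : El 2 = -El 0 - El 1 := by
  ext x; simp [El, N, X]; ring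
lemma El_mem (i : Fin 3) : El i ∈ G 1 1 := by
  fin_cases i
  · exact El0_mem
  · exact El1_mem
  · show El 2 ∈ _
    rw [El2_eq]
    exact sub_mem (neg_mem El0_mem) El1_mem
lemma X_eq (i : Fin 3) : X i = (1 / 3 : ℝ) • (El i + N) := by
  ext x; simp [El]
lemma X_mem (i : Fin 3) : X i ∈ G 1 2 := by
  rw [X_eq]
  exact Submodule.smul_mem _ _ (add_mem (G_mono (El_mem i) le_rfl (by norm_num)) N_mem)

lemma T_mul (i) (f g : Fn) : T i (f * g) = T i f * T i g := rfl
lemma Df_mul (i) (f g : Fn) : Df i (f * g) = Df i f * g + f * Df i g - Df i f * Df i g := by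
  simp only [Df, T_mul]; ring
lemma Df_add (i) (f g : Fn) : Df i (f + g) = Df i f + Df i g := by
  ext x; simp [Df, T]; ring
lemma Df_sub (i) (f g : Fn) : Df i (f - g) = Df i f - Df i g := by
  ext x; simp [Df, T]; ring
lemma Df_smul (i) (a : ℝ) (f : Fn) : Df i (a • f) = a • Df i f := by
  ext x; simp [Df, T]; ring
lemma Df_one (i) : Df i 1 = 0 := by
  ext x; simp [Df, T]
lemma Df_zero (i) : Df i 0 = 0 := by
  ext x; simp [Df, T]
lemma Df_N (i) : Df i N = 1 := by
  ext x; fin_cases i <;> simp [Df, T, N, X]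
lemma Df_El (i j) : Df i (El j) = (if i = j then (2 : ℝ) else -1) • 1 := by
  ext x; fin_cases i <;> fin_cases j <;> simp [Df, T, N, X, El] <;> ring

lemma L_add (f g : Fn) : L (f + g) = L f + L g := by
  simp only [L, Df_add, Fin.sum_univ_three]; ring
lemma L_sub (f g : Fn) : L (f - g) = L f - L g := by
  simp only [L, Df_sub, Fin.sum_univ_three]; ring
lemma L_smul (a : ℝ) (f : Fn) : L (a • f) = a • L f := by
  simp only [L, Df_smul, mul_smul_comm, Finset.smul_sum]
lemma L_one : L 1 = 0 := by simp [L, Df_one]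
lemma L_zero : L 0 = 0 := by simp [L, Df_zero]
lemma L_mul (f g : Fn) : L (f * g) = f * L g + g * L f - ∑ i, X i * (Df i f * Df i g) := by
  simp only [L, Df_mul, Fin.sum_univ_three]; ring
lemma L_N : L N = N := by
  simp [L, Df_N, Fin.sum_univ_three]; rfl
lemma L_El (j) : L (El j) = El j := by
  simp only [L, Df_El, Fin.sum_univ_three]
  ext x; fin_cases j <;> simp [El, N, X] <;> ring
lemma L_at0 (f : Fn) : L f 0 = 0 := by
  simp [L, X]

structure Good (d w : ℤ) (f : Fn) : Prop where
  mem : f ∈ G d w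
  df : ∀ i, Df i f ∈ G (d - 1) (w - 1)
  l : L f - (d : ℝ) • f ∈ G (d - 1) w

lemma Good.mul {d w d' w' : ℤ} {f g : Fn} (hf : Good d w f) (hg : Good d' w' g) :
    Good (d + d') (w + w') (f * g) where
  mem := G_mul hf.mem hg.mem
  df i := by
    rw [Df_mul]
    refine sub_mem (add_mem ?_ ?_) ?_
    · exact G_mono (G_mul (hf.df i) hg.mem) (by linarith) (by linarith)
    · exact G_mono (G_mul hf.mem (hg.df i)) (by linarith) (by linarith)
    · exact G_mono (G_mul (hf.df i) (hg.df i)) (by linarith) (by linarith)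
  l := by
    have e : L (f * g) - ((d + d' : ℤ) : ℝ) • (f * g) = f * (L g - (d' : ℝ) • g)
        + (L f - (d : ℝ) • f) * g - ∑ i, X i * (Df i f * Df i g) := by
      rw [L_mul]; ext x; simp; ring
    rw [e]
    refine sub_mem (add_mem ?_ ?_) (sum_mem fun i _ => ?_)
    · exact G_mono (G_mul hf.mem hg.l) (by linarith) (by linarith)
    · exact G_mono (G_mul hf.l hg.mem) (by linarith) (by linarith)
    · exact G_mono (G_mul (X_mem i) (G_mul (hf.df i) (hg.df i))) (by linarith) (by linarith)

lemma Good_one : Good 0 0 1 where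
  mem := one_mem
  df i := by rw [Df_one]; exact zero_mem _
  l := by simp [L_one]

lemma Good_N : Good 1 2 N where
  mem := N_mem
  df i := by rw [Df_N]; exact G_mono one_mem (by norm_num) (by norm_num)
  l := by simp [L_N]

lemma Good_El (j) : Good 1 1 (El j) where
  mem := El_mem j
  df i := by
    rw [Df_El]; exact Submodule.smul_mem _ _ (G_mono one_mem (by norm_num) (by norm_num))
  l := by simp [L_El]

lemma Good.pow {d w : ℤ} {f : Fn} (hf : Good d w f) (n : ℕ) : Good (n * d) (n * w) (f ^ n) := by
  induction n with
  | zero => simpa using Good_one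
  | succ n ih =>
    have := ih.mul hf
    rw [pow_succ]
    convert this using 1 <;> push_cast <;> ring

lemma Good_mono (i j k : ℕ) : Good (i + j + k) (2 * i + j + k) (N ^ i * El 0 ^ j * El 1 ^ k) := by
  have := ((Good_N.pow i).mul ((Good_El 0).pow j)).mul ((Good_El 1).pow k)
  convert this using 1 <;> ring

lemma G_df {d w : ℤ} {f : Fn} (hf : f ∈ G d w) (t) : Df t f ∈ G (d - 1) (w - 1) := by
  induction hf using Submodule.span_induction with
  | mem f h =>
    obtain ⟨i, j, k, a, b, rfl⟩ := h
    exact G_mono ((Good_mono i j k).df t) (by linarith) (by linarith)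
  | zero => rw [Df_zero]; exact zero_mem _
  | add f g _ _ hf hg => rw [Df_add]; exact add_mem hf hg
  | smul a f _ hf => rw [Df_smul]; exact Submodule.smul_mem _ _ hf

lemma at0 (i j k : ℕ) (h : 0 < i + j + k) : (N ^ i * El 0 ^ j * El 1 ^ k : Fn) 0 = 0 := by
  simp [N, X, El]; omega

lemma solve' (n : ℕ) : ∀ (w : ℤ) (f : Fn), f ∈ G n w →
    ∃ h ∈ G n w, h 0 = 0 ∧ L h = f - (f 0) • 1 := by
  induction n with
  | zero =>
    intro w f hf
    refine ⟨0, zero_mem _, rfl, ?_⟩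
    rw [L_zero]
    induction hf using Submodule.span_induction with
    | mem f h =>
      obtain ⟨i, j, k, a, b, rfl⟩ := h
      obtain ⟨rfl, rfl, rfl⟩ : i = 0 ∧ j = 0 ∧ k = 0 := by
        push_cast at a; omega
      simp
    | zero => simp
    | add f g _ _ hf hg =>
      ext x
      have h1 := congrFun hf x
      have h2 := congrFun hg x
      simp at h1 h2 ⊢; linarith
    | smul a f _ hf =>
      ext x
      have h1 := congrFun hf x
      simp at h1 ⊢
      linear_combination a * h1
  | succ n ih =>
    intro w f hf
    induction hf using Submodule.span_induction with
    | mem f h =>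
      obtain ⟨i, j, k, a, b, rfl⟩ := h
      rcases Nat.eq_zero_or_pos (i + j + k) with h0 | h0
      · obtain ⟨rfl, rfl, rfl⟩ : i = 0 ∧ j = 0 ∧ k = 0 := by omega
        refine ⟨0, zero_mem _, rfl, ?_⟩
        rw [L_zero]; simp
      · have gd := Good_mono i j k
        have z := at0 i j k h0
        set f : Fn := N ^ i * El 0 ^ j * El 1 ^ k
        obtain ⟨h, hh, h0', hL⟩ := ih w _ (G_mono gd.l (by push_cast at a; linarith) b)
        have ne : ((i + j + k : ℤ) : ℝ) ≠ 0 := by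
          have : (0 : ℝ) < ((i + j + k : ℕ) : ℝ) := by exact_mod_cast h0
          push_cast at this ⊢; exact this.ne'
        refine ⟨((i + j + k : ℤ) : ℝ)⁻¹ • (f - h), ?_, ?_, ?_⟩
        · refine Submodule.smul_mem _ _ (sub_mem (G_mono gd.mem (by exact_mod_cast a) b)
            (G_mono hh (by push_cast; linarith) le_rfl))
        · simp [z, h0']
        · rw [L_smul, L_sub, hL]
          ext x
          simp only [Pi.smul_apply, Pi.sub_apply, L_at0, z, smul_eq_mul, Pi.one_apply]
          field_simp
          ring
    | zero => exact ⟨0, zero_mem _, rfl, by rw [L_zero]; simp⟩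
    | add f g _ _ hf hg =>
      obtain ⟨h1, a1, b1, c1⟩ := hf
      obtain ⟨h2, a2, b2, c2⟩ := hg
      refine ⟨h1 + h2, add_mem a1 a2, by simp [b1, b2], ?_⟩
      rw [L_add, c1, c2]; ext x; simp; ring
    | smul a f _ hf =>
      obtain ⟨h1, a1, b1, c1⟩ := hf
      refine ⟨a • h1, Submodule.smul_mem _ _ a1, by simp [b1], ?_⟩
      rw [L_smul, c1]; ext x; simp; ring

/-- weight filtration -/
def F (w : ℤ) : Submodule ℝ Fn := G w w

lemma F_mono {w w' : ℤ} {f : Fn} (hf : f ∈ F w) (h : w ≤ w') : f ∈ F w' := G_mono hf h h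
lemma F_mul {w w' : ℤ} {f g : Fn} (hf : f ∈ F w) (hg : g ∈ F w') : f * g ∈ F (w + w') :=
  G_mul hf hg
lemma F_mul' {w w' v : ℤ} {f g : Fn} (hf : f ∈ F w) (hg : g ∈ F w') (h : w + w' ≤ v) :
    f * g ∈ F v := F_mono (F_mul hf hg) h
lemma F_pow {w : ℤ} {f : Fn} (hf : f ∈ F w) (n : ℕ) : f ^ n ∈ F (n * w) := by
  induction n with
  | zero => simpa using (show (1 : Fn) ∈ F 0 from one_mem)
  | succ n ih => rw [pow_succ]; exact F_mul' ih hf (by push_cast; linarith)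
lemma F_df {w : ℤ} {f : Fn} (hf : f ∈ F w) (t) : Df t f ∈ F (w - 1) := G_df hf t
lemma F_T {w : ℤ} {f : Fn} (hf : f ∈ F w) (t) : T t f ∈ F w := by
  have : T t f = f - Df t f := by simp [Df]
  rw [this]
  exact sub_mem hf (F_mono (F_df hf t) (by linarith))
lemma F_one : (1 : Fn) ∈ F 0 := one_mem
lemma FX (i) : X i ∈ F 2 := G_mono (X_mem i) (by norm_num) le_rfl
lemma FN : N ∈ F 2 := G_mono N_mem (by norm_num) le_rfl
lemma FEl (i) : El i ∈ F 1 := El_mem i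

lemma solve (w : ℕ) (f : Fn) (hf : f ∈ F w) (h0 : f 0 = 0) :
    ∃ h ∈ F w, h 0 = 0 ∧ L h = f := by
  obtain ⟨h, a, b, c⟩ := solve' w w f hf
  exact ⟨h, a, b, by rw [c, h0]; simp⟩

/-- radial part -/
noncomputable def Sg : Fn := (1 / 3 : ℝ) • (El 0 ^ 2 + El 1 ^ 2 + El 2 ^ 2)

lemma FSg : Sg ∈ F 2 := by
  refine Submodule.smul_mem _ _ (add_mem (add_mem ?_ ?_) ?_) <;>
  exact F_mono (F_pow (FEl _) 2) (by norm_num)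

lemma Df_Sg (i) : Df i Sg = (2 : ℝ) • El i - (2 : ℝ) • 1 := by
  ext x; fin_cases i <;> simp [Df, T, Sg, El, N, X] <;> ring

lemma L_Sg : L Sg = (2 : ℝ) • Sg - (2 : ℝ) • N := by
  simp only [L, Df_Sg, Fin.sum_univ_three]
  ext x; simp [Sg, El, N, X]; ring

structure Rad (w : ℤ) (f g h : Fn) : Prop where
  mem : f ∈ F w
  gm : g ∈ F (w - 2)
  df : ∀ i, Df i f - g * El i ∈ F (w - 2)
  l : L f - h ∈ F (w - 1)

lemma XEE : ∑ i, X i * (El i * El i) - N * Sg ∈ F 3 := by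
  have : ∑ i, X i * (El i * El i) - N * Sg = (1 / 3 : ℝ) • ∑ i, El i ^ 3 := by
    simp only [Fin.sum_univ_three]
    ext x; simp [Sg, El, N, X]; ring
  rw [this]
  exact Submodule.smul_mem _ _ (sum_mem fun i _ => F_mono (F_pow (FEl _) 3) (by norm_num))

lemma Rad.df' {w f g h} (H : Rad w f g h) (i) : Df i f ∈ F (w - 1) := F_df H.mem i

lemma Rad.mul {w f g h w' f' g' h'} (H : Rad w f g h) (H' : Rad w' f' g' h') :
    Rad (w + w') (f * f') (g * f' + f * g') (f * h' + f' * h - N * Sg * (g * g')) where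
  mem := F_mul H.mem H'.mem
  gm := add_mem (F_mul' H.gm H'.mem (by linarith)) (F_mul' H.mem H'.gm (by linarith))
  df i := by
    have e : Df i (f * f') - (g * f' + f * g') * El i = (Df i f - g * El i) * f'
      + f * (Df i f' - g' * El i) - Df i f * Df i f' := by rw [Df_mul]; ring
    rw [e]
    exact sub_mem (add_mem (F_mul' (H.df i) H'.mem (by linarith))
      (F_mul' H.mem (H'.df i) (by linarith))) (F_mul' (H.df' i) (H'.df' i) (by linarith))
  l := by
    have e : L (f * f') - (f * h' + f' * h - N * Sg * (g * g')) =
      f * (L f' - h') + f' * (L f - h) - (∑ i, X i * ((Df i f - g * El i) * Df i f'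
        + g * El i * (Df i f' - g' * El i))) - 
        (∑ i, X i * (El i * El i) - N * Sg) * (g * g') := by
      rw [L_mul]; simp only [Fin.sum_univ_three]; ring
    rw [e]
    refine sub_mem (sub_mem (add_mem ?_ ?_) (sum_mem fun i _ => ?_)) ?_
    · exact F_mul' H.mem H'.l (by linarith)
    · exact F_mul' H'.mem H.l (by linarith)
    · refine F_mul' (w' := w + w' - 3) (FX i) (add_mem ?_ ?_) (by linarith)
      · exact F_mul' (H.df i) (H'.df' i) (by linarith)
      · exact F_mul' (F_mul H.gm (FEl i)) (H'.df i) (by linarith)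
    · exact F_mul' XEE (F_mul H.gm H'.gm) (by linarith)

lemma Rad_one : Rad 0 1 0 0 where
  mem := one_mem
  gm := zero_mem _
  df i := by rw [Df_one]; simp
  l := by rw [L_one]; simp
lemma Rad_N : Rad 2 N 0 N where
  mem := FN
  gm := zero_mem _
  df i := by rw [Df_N]; simpa using F_one
  l := by rw [L_N]; simp
lemma Rad_Sg : Rad 2 Sg ((2 : ℝ) • 1) ((2 : ℝ) • Sg - (2 : ℝ) • N) where
  mem := FSg
  gm := Submodule.smul_mem _ _ one_mem
  df i := by
    have e : (2 : ℝ) • El i - (2 : ℝ) • 1 - ((2 : ℝ) • 1) * El i = (-2 : ℝ) • (1 : Fn) := by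
      ext x; simp
    rw [Df_Sg, e]; exact Submodule.smul_mem _ _ F_one
  l := by rw [L_Sg]; simp

lemma Rad.zero (w) : Rad w 0 0 0 where
  mem := zero_mem _
  gm := zero_mem _
  df i := by rw [Df_zero]; simp
  l := by rw [L_zero]; simp

lemma Rad.add {w f g h f' g' h'} (H : Rad w f g h) (H' : Rad w f' g' h') :
    Rad w (f + f') (g + g') (h + h') where
  mem := add_mem H.mem H'.mem
  gm := add_mem H.gm H'.gm
  df i := by
    convert add_mem (H.df i) (H'.df i) using 1
    rw [Df_add]; ring
  l := by
    convert add_mem H.l H'.l using 1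
    rw [L_add]; ring

lemma Rad.smul {w f g h} (a : ℝ) (H : Rad w f g h) : Rad w (a • f) (a • g) (a • h) where
  mem := Submodule.smul_mem _ _ H.mem
  gm := Submodule.smul_mem _ _ H.gm
  df i := by
    convert Submodule.smul_mem _ a (H.df i) using 1
    rw [Df_smul]; ext x; simp; ring
  l := by
    convert Submodule.smul_mem _ a H.l using 1
    rw [L_smul]; ext x; simp; ring

lemma Rad.congr {w f g h w' f' g' h'} (H : Rad w f g h) (a : w' = w) (b : f' = f) (c : g' = g)
    (d : h' = h) : Rad w' f' g' h' := by
  subst a b c d; exact H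

lemma Rad_Npow (p : ℕ) : Rad (2 * p) (N ^ p) 0 ((p : ℝ) • N ^ p) := by
  induction p with
  | zero => simpa using Rad_one
  | succ p ih =>
    refine (ih.mul Rad_N).congr (by push_cast; ring) (pow_succ _ _) (by simp) ?_
    ext x; simp; ring

lemma Rad_Sgpow (q : ℕ) : Rad (2 * q) (Sg ^ q) ((2 * q : ℝ) • Sg ^ (q - 1))
    ((2 * q : ℝ) • Sg ^ q - (2 * q ^ 2 : ℝ) • (N * Sg ^ (q - 1))) := by
  induction q with
  | zero => simpa using Rad_one
  | succ q ih =>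
    refine (ih.mul Rad_Sg).congr (by push_cast; ring) (pow_succ _ _) ?_ ?_
    · rcases q with _ | q
      · ext x; simp
      · ext x; simp; ring
    · rcases q with _ | q
      · ext x; simp
      · ext x; simp; ring

lemma Rad_mono (p q : ℕ) : ∃ g, Rad (2 * (p + q)) (N ^ p * Sg ^ q) g
    ((p + 2 * q : ℝ) • (N ^ p * Sg ^ q) - (2 * q ^ 2 : ℝ) • (N ^ (p + 1) * Sg ^ (q - 1))) := by
  refine ⟨_, ((Rad_Npow p).mul (Rad_Sgpow q)).congr (by ring) rfl rfl ?_⟩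
  ext x; simp; ring

/-- the coefficients of the leading part -/
noncomputable def co : ℕ → ℕ → ℝ
  | 0, 0 => 1
  | 2, 0 => 1/9
  | 2, 1 => 1/9
  | 4, 0 => 7/135
  | 4, 1 => 14/135
  | 4, 2 => 1/27
  | 6, 0 => 31/567
  | 6, 1 => 31/189
  | 6, 2 => 1/9
  | 6, 3 => 5/243
  | 8, 0 => 127/1215
  | 8, 1 => 508/1215
  | 8, 2 => 494/1215
  | 8, 3 => 308/2187
  | 8, 4 => 35/2187
  | 10, 0 => 2555/8019
  | 10, 1 => 12775/8019
  | 10, 2 => 1454/729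
  | 10, 3 => 2146/2187
  | 10, 4 => 455/2187
  | 10, 5 => 35/2187
  | 12, 0 => 1414477/995085
  | 12, 1 => 2828954/331695
  | 12, 2 => 12269/945
  | 12, 3 => 267388/32805
  | 12, 4 => 5357/2187
  | 12, 5 => 770/2187
  | 12, 6 => 385/19683
  | _, _ => 0

noncomputable def P (r : ℕ) : Fn :=
  ∑ q ∈ range (r + 1), co r q • (N ^ (r - q) * Sg ^ q)
noncomputable def H (r : ℕ) : Fn :=
  ∑ q ∈ range (r + 1), co r q • (((r - q : ℕ) + 2 * q : ℝ) • (N ^ (r - q) * Sg ^ q)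
    - (2 * q ^ 2 : ℝ) • (N ^ (r - q + 1) * Sg ^ (q - 1)))

lemma Rad_sum {ι : Type*} (s : Finset ι) (w : ℤ) (f h : ι → Fn)
    (hh : ∀ i ∈ s, ∃ g, Rad w (f i) g (h i)) : ∃ g, Rad w (∑ i ∈ s, f i) g (∑ i ∈ s, h i) := by
  classical
  induction s using Finset.induction_on with
  | empty => exact ⟨0, by simpa using Rad.zero w⟩
  | insert a s ha ih =>
    obtain ⟨g, hg⟩ := ih fun i hi => hh i (mem_insert_of_mem hi)
    obtain ⟨g', hg'⟩ := hh a (mem_insert_self _ _)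
    rw [sum_insert ha, sum_insert ha]
    exact ⟨_, hg'.add hg⟩

lemma Rad_P (r : ℕ) : ∃ g, Rad (2 * r) (P r) g (H r) := by
  refine Rad_sum _ _ _ _ fun q hq => ?_
  obtain ⟨g, hg⟩ := Rad_mono (r - q) q
  have hq : q ≤ r := by simp at hq; omega
  refine ⟨_, (hg.smul (co r q)).congr ?_ rfl rfl rfl⟩
  rw [Nat.cast_sub hq]; ring

set_option maxHeartbeats 4000000 in
lemma H_eq (r : ℕ) (h1 : 1 ≤ r) (h2 : r ≤ 12) : H r = ∑ s ∈ range r,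
    if s + 2 = r then ((r.choose s : ℝ) / 3) • (N * Sg * P s) else 0 := by
  ext x
  interval_cases r <;> simp [H, P, sum_range_succ, co, Nat.choose] <;> ring

def dd (i : Fin 3) : Fn := X (i + 1) - X (i + 2)

lemma Fdd (i) : dd i ∈ F 1 := by
  have e : dd i = (1 / 3 : ℝ) • (El (i + 1) - El (i + 2)) := by
    ext x; simp [dd, El]; ring
  rw [e]
  exact Submodule.smul_mem _ _ (sub_mem (FEl _) (FEl _))

lemma Xd1 : ∑ i, X i * dd i = 0 := by
  ext x; simp [Fin.sum_univ_three, dd, X]; ring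

lemma Xd1E : ∑ i, X i * dd i * El i ∈ F 3 := by
  have e : ∑ i, X i * dd i * El i = (1 / 3 : ℝ) • ∑ i, dd i * El i ^ 2 := by
    ext x; simp [Fin.sum_univ_three, dd, X, El, N]; ring
  rw [e]
  exact Submodule.smul_mem _ _ (sum_mem fun i _ => F_mul' (Fdd i) (F_pow (FEl i) 2) (by norm_num))

lemma Xd2 : ∑ i, X i * dd i ^ 2 - (1 / 3 : ℝ) • (N * Sg) ∈ F 3 := by
  have e : ∑ i, X i * dd i ^ 2 - (1 / 3 : ℝ) • (N * Sg) = (1 / 3 : ℝ) • ∑ i, El i * dd i ^ 2 := by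
    ext x; simp [Fin.sum_univ_three, dd, X, El, N, Sg]; ring
  rw [e]
  exact Submodule.smul_mem _ _ (sum_mem fun i _ => F_mul' (FEl i) (F_pow (Fdd i) 2) (by norm_num))

lemma FP (r : ℕ) : P r ∈ F (2 * r) := (Rad_P r).choose_spec.mem

lemma T_eq (i f) : T i f = f - Df i f := by simp [Df]

lemma step_term (r s : ℕ) (hs : s < r) (p : Fn) (hp : p - P s ∈ F (2 * s - 1)) :
    ((r.choose s : ℝ) • ∑ i, X i * dd i ^ (r - s) * T i p) -
      (if s + 2 = r then ((r.choose s : ℝ) / 3) • (N * Sg * P s) else 0) ∈ F (2 * r - 1) := by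
  have pm : p ∈ F (2 * s) := by
    have := add_mem (F_mono hp (by linarith : (2 * s - 1 : ℤ) ≤ 2 * s)) (FP s)
    simpa using this
  split_ifs with h
  · subst h
    have e : ((s + 2).choose s : ℝ) • ∑ i, X i * dd i ^ (s + 2 - s) * T i p -
        (((s + 2).choose s : ℝ) / 3) • (N * Sg * P s) = ((s + 2).choose s : ℝ) •
        ((∑ i, X i * dd i ^ 2 - (1 / 3 : ℝ) • (N * Sg)) * p
          + (1 / 3 : ℝ) • (N * Sg * (p - P s))
          - ∑ i, X i * dd i ^ 2 * Df i p) := by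
      simp only [T_eq, Fin.sum_univ_three, Nat.add_sub_cancel_left]
      ext x; simp; ring
    rw [e]
    refine Submodule.smul_mem _ _ (sub_mem (add_mem ?_ ?_) (sum_mem fun i _ => ?_))
    · exact F_mul' Xd2 pm (by push_cast; linarith)
    · exact Submodule.smul_mem _ _ (F_mul' (F_mul FN FSg) hp (by push_cast; linarith))
    · exact F_mul' (F_mul (FX i) (F_pow (Fdd i) 2)) (F_df pm i) (by push_cast; linarith)
  · rw [sub_zero]
    refine Submodule.smul_mem _ _ ?_
    by_cases h1 : s + 1 = r
    · subst h1
      obtain ⟨g, hg⟩ := Rad_P s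
      have e : ∑ i, X i * dd i ^ (s + 1 - s) * T i p = (∑ i, X i * dd i) * p
          - (∑ i, X i * dd i * El i) * g
          - ∑ i, X i * dd i * ((Df i (P s) - g * El i) + Df i (p - P s)) := by
        simp only [T_eq, Df_sub, Fin.sum_univ_three, Nat.add_sub_cancel_left]
        ring
      rw [e, Xd1, zero_mul, zero_sub]
      refine sub_mem (neg_mem ?_) (sum_mem fun i _ => ?_)
      · exact F_mul' Xd1E hg.gm (by push_cast; linarith)
      · exact F_mul' (F_mul (FX i) (Fdd i)) (add_mem (hg.df i) (F_mono (F_df hp i) (by linarith)))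
          (by push_cast; linarith)
    · refine sum_mem fun i _ => ?_
      refine F_mul' (F_mul (FX i) (F_pow (Fdd i) _)) (F_T pm i) ?_
      rw [Nat.cast_sub hs.le]
      have : s + 3 ≤ r := by omega
      have : (s : ℤ) + 3 ≤ r := by exact_mod_cast this
      linarith

lemma P_at0 (r : ℕ) (hr : 1 ≤ r) : P r 0 = 0 := by
  simp only [P, Finset.sum_apply, Pi.smul_apply, Pi.mul_apply, Pi.pow_apply]
  refine sum_eq_zero fun q hq => ?_
  have : q ≤ r := by simp at hq; omega
  rcases Nat.eq_zero_or_pos q with rfl | h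
  · have : N 0 = 0 := by simp [N, X]
    simp [this]; right; omega
  · have : Sg 0 = 0 := by simp [Sg, El, N, X]
    simp [this]; right; right; omega

lemma step (r : ℕ) (h1 : 1 ≤ r) (h2 : r ≤ 12) (p : ℕ → Fn)
    (hp : ∀ s < r, p s - P s ∈ F (2 * s - 1)) :
    ∃ f : Fn, f - P r ∈ F (2 * r - 1) ∧ f 0 = 0 ∧
      L f = ∑ s ∈ range r, (r.choose s : ℝ) • ∑ i, X i * dd i ^ (r - s) * T i (p s) := by
  obtain ⟨g, hg⟩ := Rad_P r
  have key : (∑ s ∈ range r, (r.choose s : ℝ) • ∑ i, X i * dd i ^ (r - s) * T i (p s)) - L (P r)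
      ∈ F (2 * r - 1) := by
    have e : (∑ s ∈ range r, (r.choose s : ℝ) • ∑ i, X i * dd i ^ (r - s) * T i (p s)) - L (P r)
      = (∑ s ∈ range r, ((r.choose s : ℝ) • ∑ i, X i * dd i ^ (r - s) * T i (p s)
        - (if s + 2 = r then ((r.choose s : ℝ) / 3) • (N * Sg * P s) else 0)))
        - (L (P r) - H r) := by
      rw [sum_sub_distrib, H_eq r h1 h2]; ring
    rw [e]
    exact sub_mem (sum_mem fun s hs => step_term r s (by simpa using hs) _
      (hp s (by simpa using hs))) hg.l
  obtain ⟨h, a, b, c⟩ := solve (2 * r - 1) _ (by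
      have : ((2 * r - 1 : ℕ) : ℤ) = 2 * r - 1 := by omega
      rw [this]; exact key) (by
      simp [L_at0, X])
  refine ⟨h + P r, ?_, ?_, ?_⟩
  · have : ((2 * r - 1 : ℕ) : ℤ) = 2 * r - 1 := by omega
    rw [this] at a
    simpa using a
  · simp [b, P_at0 r h1]
  · rw [L_add, c]; ring

end Gp

namespace Gp
open Finset

/-- condition defining the statistic -/
abbrev Cd (x y z : ℕ) : Prop := (x < z ∧ z < y) ∨ (y < x ∧ x < z) ∨ (z < y ∧ y < x)

lemma gep_eq (w : List ℕ) : (gep w : ℤ) = ∑ i : Fin w.length, ∑ j : Fin w.length,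
    ∑ k : Fin w.length, if i < j ∧ j < k ∧ Cd (w.get i) (w.get j) (w.get k) then 1 else 0 := by
  unfold gep
  rw [card_filter]
  push_cast
  rw [Fintype.sum_prod_type]
  refine sum_congr rfl fun i _ => ?_
  rw [Fintype.sum_prod_type]

/-- number of (u before v) pairs -/
def nn (u v : ℕ) : List ℕ → ℤ
  | [] => 0
  | x :: w => nn u v w + if x = u then (w.count v : ℤ) else 0

lemma nn_add (u v : ℕ) (h : u ≠ v) (w : List ℕ) :
    nn u v w + nn v u w = w.count u * w.count v := by
  induction w with
  | nil => simp [nn]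
  | cons x w ih =>
    simp only [nn, List.count_cons]
    by_cases h1 : x = u
    · subst h1; simp [h]; linarith
    · by_cases h2 : x = v
      · subst h2; simp [h1]; linarith
      · simp [h1, h2, ih]

lemma get_succ (x : ℕ) (w : List ℕ) (i : Fin w.length) :
    (x :: w).get (Fin.succ i : Fin (w.length + 1)) = w.get i := rfl

lemma sum_one (R : ℕ → Prop) [DecidablePred R] (w : List ℕ) :
    (∑ k : Fin w.length, if R (w.get k) then (1 : ℤ) else 0) = w.countP (fun x => R x) := by
  induction w with
  | nil => simp
  | cons x w ih =>
    have := Fin.sum_univ_succ (n := w.length)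
      (fun k : Fin (w.length + 1) => if R ((x :: w).get k) then (1 : ℤ) else 0)
    refine this.trans ?_
    simp only [get_succ, List.countP_cons]
    rw [ih]
    simp only [decide_eq_true_eq, Nat.cast_add, Nat.cast_ite, Nat.cast_one, Nat.cast_zero]
    exact add_comm _ _

lemma sum_two (Q : ℕ → ℕ → Prop) [∀ x y, Decidable (Q x y)] (u v : ℕ) (w : List ℕ)
    (hQ : ∀ x ∈ w, ∀ y ∈ w, Q x y ↔ x = u ∧ y = v) :
    (∑ j : Fin w.length, ∑ k : Fin w.length, if j < k ∧ Q (w.get j) (w.get k) then (1 : ℤ) else 0)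
      = nn u v w := by
  induction w with
  | nil => simp [nn]
  | cons x w ih =>
    refine (Fin.sum_univ_succ (n := w.length) _).trans ?_
    have e1 := fun j => Fin.sum_univ_succ (n := w.length) (fun k : Fin (w.length + 1) =>
      if j < k ∧ Q ((x :: w).get j) ((x :: w).get k) then (1 : ℤ) else 0)
    refine (congrArg₂ (· + ·) (e1 _) (sum_congr rfl fun j _ => e1 _)).trans ?_
    simp only [get_succ, Fin.succ_lt_succ_iff, Fin.succ_pos, Fin.not_lt_zero, lt_irrefl,
      true_and, false_and, if_false, zero_add]
    rw [ih fun a ha b hb => hQ a (by simp [ha]) b (by simp [hb])]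
    have e2 := sum_one (fun y => Q x y) w
    have e3 : (w.countP (fun y => Q x y) : ℤ) = if x = u then (w.count v : ℤ) else 0 := by
      split_ifs with h
      · congr 1
        refine List.countP_congr fun y hy => ?_
        rw [decide_eq_true_iff, hQ x (by simp) y (by simp [hy])]
        simp [h]
      · norm_cast
        rw [List.countP_eq_zero]
        intro y hy
        simp [hQ x (by simp) y (by simp [hy]), h]
    rw [e3] at e2
    rw [nn, ← e2, add_comm]
    rfl

lemma gep_cons (x : ℕ) (w : List ℕ) (u v : ℕ)
    (hQ : ∀ y ∈ w, ∀ z ∈ w, Cd x y z ↔ y = u ∧ z = v) :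
    (gep (x :: w) : ℤ) = gep w + nn u v w := by
  rw [gep_eq, gep_eq, ← sum_two (Cd x) u v w hQ]
  refine (Fin.sum_univ_succ (n := w.length) _).trans ?_
  rw [add_comm]
  have e1 := fun i j => Fin.sum_univ_succ (n := w.length) (fun k : Fin (w.length + 1) =>
      if i < j ∧ j < k ∧ Cd ((x :: w).get i) ((x :: w).get j) ((x :: w).get k) then (1 : ℤ) else 0)
  have e2 := fun i => (Fin.sum_univ_succ (n := w.length) (fun j => ∑ k : Fin (w.length + 1),
      if i < j ∧ j < k ∧ Cd ((x :: w).get i) ((x :: w).get j) ((x :: w).get k) then (1 : ℤ) else 0)).trans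
      (congrArg₂ (· + ·) (e1 i _) (sum_congr rfl fun j _ => e1 i _))
  refine congrArg₂ (· + ·) ?_ ?_
  · refine sum_congr rfl fun i _ => ?_
    refine (e2 _).trans ?_
    simp only [get_succ, Fin.succ_lt_succ_iff, Fin.not_lt_zero,
      false_and, and_false, if_false, zero_add, sum_const_zero]
  · refine (e2 _).trans ?_
    simp only [get_succ, Fin.succ_lt_succ_iff, Fin.succ_pos, Fin.not_lt_zero, lt_irrefl,
      true_and, false_and, and_false, if_false, zero_add, sum_const_zero]
    rfl

def Abc (w : List ℕ) : Prop := ∀ x ∈ w, x = 1 ∨ x = 2 ∨ x = 3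

lemma gep_formula (w : List ℕ) (hw : Abc w) : 2 * (gep w : ℤ) =
    w.count 1 * w.count 2 * w.count 3 - (w.count 3 * (nn 1 2 w - nn 2 1 w)
      + w.count 1 * (nn 2 3 w - nn 3 2 w) + w.count 2 * (nn 3 1 w - nn 1 3 w)) := by
  induction w with
  | nil => simp [nn, gep_eq]
  | cons x w ih =>
    have hw' : Abc w := fun y hy => hw y (by simp [hy])
    have ih := ih hw'
    have h12 := nn_add 1 2 (by norm_num) w
    have h23 := nn_add 2 3 (by norm_num) w
    have h31 := nn_add 3 1 (by norm_num) w
    rcases hw x (by simp) with rfl | rfl | rfl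
    · rw [gep_cons 1 w 3 2 (fun y hy z hz => by
        rcases hw' y hy with rfl | rfl | rfl <;> rcases hw' z hz with rfl | rfl | rfl <;> simp [Cd])]
      simp [nn]
      linear_combination ih + h23
    · rw [gep_cons 2 w 1 3 (fun y hy z hz => by
        rcases hw' y hy with rfl | rfl | rfl <;> rcases hw' z hz with rfl | rfl | rfl <;> simp [Cd])]
      simp [nn]
      linear_combination ih + h31
    · rw [gep_cons 3 w 2 1 (fun y hy z hz => by
        rcases hw' y hy with rfl | rfl | rfl <;> rcases hw' z hz with rfl | rfl | rfl <;> simp [Cd])]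
      simp [nn]
      linear_combination ih + h12

def Ar (w : List ℕ) : ℤ :=
  nn 1 2 w - nn 2 1 w + (nn 2 3 w - nn 3 2 w) + (nn 3 1 w - nn 1 3 w)

lemma mem_W (a b c : ℕ) (w : List ℕ) : w ∈ W a b c ↔
    Abc w ∧ w.count 1 = a ∧ w.count 2 = b ∧ w.count 3 = c := by
  simp only [W, List.mem_toFinset, List.mem_permutations]
  constructor
  · intro h
    refine ⟨fun x hx => ?_, ?_, ?_, ?_⟩
    · have := h.mem_iff.1 hx
      simp at this
      tauto
    all_goals rw [h.count_eq]; simp [List.count_replicate]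
  · rintro ⟨h, rfl, rfl, rfl⟩
    rw [List.perm_iff_count]
    intro x
    simp only [List.count_append, List.count_replicate]
    by_cases h1 : x = 1
    · subst h1; simp
    by_cases h2 : x = 2
    · subst h2; simp
    by_cases h3 : x = 3
    · subst h3; simp
    have : x ∉ w := fun hx => by rcases h x hx with h | h | h <;> contradiction
    rw [List.count_eq_zero_of_not_mem this]
    simp [Ne.symm h1, Ne.symm h2, Ne.symm h3]

lemma Abc_cons (x w) : Abc (x :: w) ↔ (x = 1 ∨ x = 2 ∨ x = 3) ∧ Abc w := by
  simp [Abc]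

lemma W_rec (a b c : ℕ) (h : 0 < a + b + c) : W a b c =
    (if a = 0 then ∅ else (W (a - 1) b c).image (List.cons 1)) ∪
    ((if b = 0 then ∅ else (W a (b - 1) c).image (List.cons 2)) ∪
    (if c = 0 then ∅ else (W a b (c - 1)).image (List.cons 3))) := by
  have e : ∀ (n : ℕ) (S : Finset (List ℕ)) (w : List ℕ),
      w ∈ (if n = 0 then ∅ else S) ↔ n ≠ 0 ∧ w ∈ S := by
    intro n S w; split_ifs with h <;> simp [h]
  ext w
  simp only [mem_union, e, mem_image, mem_W]
  cases w with
  | nil => simp [Abc]; omega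
  | cons x w =>
    simp only [Abc_cons, List.count_cons, List.cons.injEq]
    constructor
    · rintro ⟨⟨rfl | rfl | rfl, hw⟩, rfl, rfl, rfl⟩
      · left; simp [hw]
      · right; left; simp [hw]
      · right; right; simp [hw]
    · rintro (⟨h0, w', ⟨hw, h1, h2, h3⟩, rfl, rfl⟩ | ⟨h0, w', ⟨hw, h1, h2, h3⟩, rfl, rfl⟩ |
        ⟨h0, w', ⟨hw, h1, h2, h3⟩, rfl, rfl⟩) <;> simp [hw] <;> omega

lemma W_sum (a b c : ℕ) (h : 0 < a + b + c) (f : List ℕ → ℝ) : ∑ w ∈ W a b c, f w =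
    (if a = 0 then 0 else ∑ w ∈ W (a - 1) b c, f (1 :: w)) +
    ((if b = 0 then 0 else ∑ w ∈ W a (b - 1) c, f (2 :: w)) +
    (if c = 0 then 0 else ∑ w ∈ W a b (c - 1), f (3 :: w))) := by
  have e : ∀ (n x : ℕ) (S : Finset (List ℕ)) (w : List ℕ),
      w ∈ (if n = 0 then ∅ else S.image (List.cons x)) → w.head? = some x := by
    intro n x S w; split_ifs with h
    · simp
    · simp only [mem_image]; rintro ⟨w, -, rfl⟩; rfl
  have e2 : ∀ (n x : ℕ) (S : Finset (List ℕ)),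
      ∑ w ∈ (if n = 0 then ∅ else S.image (List.cons x)), f w =
        if n = 0 then 0 else ∑ w ∈ S, f (x :: w) := by
    intro n x S; split_ifs with h
    · simp
    · rw [sum_image]; intro u _ v _ h; simpa using h
  rw [W_rec a b c h, sum_union, sum_union, e2, e2, e2]
  · rw [disjoint_left]
    intro w h1 h2
    have h1 := e _ _ _ _ h1
    have h2 := e _ _ _ _ h2
    rw [h1] at h2; simp at h2
  · rw [disjoint_left]
    intro w h1 h2
    have h1 := e _ _ _ _ h1
    rcases mem_union.1 h2 with h2 | h2 <;>
    · have h2 := e _ _ _ _ h2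
      rw [h1] at h2; simp at h2

noncomputable def Mom (r a b c : ℕ) : ℝ := ∑ w ∈ W a b c, (Ar w : ℝ) ^ r

noncomputable def K (a b c : ℕ) : ℝ :=
  ((a + b + c).factorial : ℝ) / (a.factorial * b.factorial * c.factorial)

lemma K_pos (a b c) : 0 < K a b c := by unfold K; positivity

lemma K1 (a b c : ℕ) : ((a + 1 : ℕ) + b + c : ℝ) * K a b c = (a + 1 : ℕ) * K (a + 1) b c := by
  unfold K
  rw [show a + 1 + b + c = (a + b + c) + 1 by ring, Nat.factorial_succ, Nat.factorial_succ]
  push_cast; field_simp; ring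
lemma K2 (a b c : ℕ) : (a + (b + 1 : ℕ) + c : ℝ) * K a b c = (b + 1 : ℕ) * K a (b + 1) c := by
  unfold K
  rw [show a + (b + 1) + c = (a + b + c) + 1 by ring, Nat.factorial_succ, Nat.factorial_succ]
  push_cast; field_simp; ring
lemma K3 (a b c : ℕ) : (a + b + (c + 1 : ℕ) : ℝ) * K a b c = (c + 1 : ℕ) * K a b (c + 1) := by
  unfold K
  rw [show a + b + (c + 1) = (a + b + c) + 1 by ring, Nat.factorial_succ, Nat.factorial_succ]
  push_cast; field_simp; ring

lemma Mom_shift (r a b c x : ℕ) (d : ℝ)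
    (hd : ∀ w ∈ W a b c, (Ar (x :: w) : ℝ) = Ar w + d) :
    ∑ w ∈ W a b c, (Ar (x :: w) : ℝ) ^ r =
      ∑ s ∈ range (r + 1), (r.choose s : ℝ) * d ^ (r - s) * Mom s a b c := by
  simp only [Mom, mul_sum]
  rw [sum_comm]
  refine sum_congr rfl fun w hw => ?_
  rw [hd w hw, add_pow]
  refine sum_congr rfl fun s _ => ?_
  ring

lemma Ar1 (a b c : ℕ) : ∀ w ∈ W a b c, (Ar (1 :: w) : ℝ) = Ar w + ((b : ℝ) - c) := by
  intro w hw
  obtain ⟨_, rfl, rfl, rfl⟩ := (mem_W _ _ _ _).1 hw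
  simp [Ar, nn]; ring
lemma Ar2 (a b c : ℕ) : ∀ w ∈ W a b c, (Ar (2 :: w) : ℝ) = Ar w + ((c : ℝ) - a) := by
  intro w hw
  obtain ⟨_, rfl, rfl, rfl⟩ := (mem_W _ _ _ _).1 hw
  simp [Ar, nn]; ring
lemma Ar3 (a b c : ℕ) : ∀ w ∈ W a b c, (Ar (3 :: w) : ℝ) = Ar w + ((a : ℝ) - b) := by
  intro w hw
  obtain ⟨_, rfl, rfl, rfl⟩ := (mem_W _ _ _ _).1 hw
  simp [Ar, nn]; ring

lemma m_eq (r n : ℕ) : m r n = (-(n : ℝ) / 2) ^ r * (Mom r n n n / Mom 0 n n n) := by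
  unfold m
  rw [← mul_div_assoc]
  congr 1
  · rw [Mom, mul_sum]
    refine sum_congr rfl fun w hw => ?_
    obtain ⟨h, h1, h2, h3⟩ := (mem_W _ _ _ _).1 hw
    have := gep_formula w h
    rw [h1, h2, h3] at this
    rw [← mul_pow]
    congr 1
    have t : (2 : ℝ) * gep w = n * n * n - n * (Ar w : ℝ) := by
      have : 2 * (gep w : ℤ) = n * n * n - n * Ar w := by rw [this, Ar]; ring
      exact_mod_cast this
    linear_combination t / 2
  · simp [Mom]

end Gp

namespace Gp
open Finset Filter Topology

def vec (a b c : ℕ) : Fin 3 → ℝ := ![(a : ℝ), b, c]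

lemma vec1 (a b c : ℕ) : vec (a + 1) b c - Pi.single 0 1 = vec a b c := by
  ext i; fin_cases i <;> simp [vec]
lemma vec2 (a b c : ℕ) : vec a (b + 1) c - Pi.single 1 1 = vec a b c := by
  ext i; fin_cases i <;> simp [vec]
lemma vec3 (a b c : ℕ) : vec a b (c + 1) - Pi.single 2 1 = vec a b c := by
  ext i; fin_cases i <;> simp [vec]

lemma Mom_eq (r : ℕ) (p : ℕ → Fn) (h0 : p r 0 = 0 ^ r)
    (hL : L (p r) = ∑ s ∈ range r, (r.choose s : ℝ) • ∑ i, X i * dd i ^ (r - s) * T i (p s))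
    (hs : ∀ s < r, ∀ a b c, Mom s a b c = K a b c * p s (vec a b c)) :
    ∀ n a b c, a + b + c = n → Mom r a b c = K a b c * p r (vec a b c) := by
  intro n
  induction n with
  | zero =>
    intro a b c h
    obtain ⟨rfl, rfl, rfl⟩ : a = 0 ∧ b = 0 ∧ c = 0 := by omega
    have : vec 0 0 0 = 0 := by ext i; fin_cases i <;> simp [vec]
    rw [this, h0]
    have e : W 0 0 0 = {[]} := by simp [W]
    simp [Mom, e, K, Ar, nn]
  | succ n ih =>
    intro a b c h
    have hh : ∀ s ∈ range (r + 1), ∀ a b c, a + b + c = n →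
        Mom s a b c = K a b c * p s (vec a b c) := by
      intro s hsr a b c habc
      rcases Nat.lt_succ_iff_lt_or_eq.1 (mem_range.1 hsr) with h1 | rfl
      · exact hs s h1 a b c
      · exact ih a b c habc
    have hN : (0 : ℝ) < (a : ℝ) + b + c := by
      have : 0 < a + b + c := by omega
      exact_mod_cast this
    have key := congrFun hL (vec a b c)
    have key2 : ((a : ℝ) + b + c) * p r (vec a b c) = ∑ s ∈ range (r + 1),
        (r.choose s : ℝ) * ((a : ℝ) * ((b : ℝ) - c) ^ (r - s) * p s (vec a b c - Pi.single 0 1)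
          + (b : ℝ) * ((c : ℝ) - a) ^ (r - s) * p s (vec a b c - Pi.single 1 1)
          + (c : ℝ) * ((a : ℝ) - b) ^ (r - s) * p s (vec a b c - Pi.single 2 1)) := by
      rw [sum_range_succ]
      have z : (2 : Fin 3) + 2 = 1 := rfl
      have z' : (1 : Fin 3) + 2 = 0 := rfl
      have z3 : (1 : Fin 3) + 1 = 2 := rfl
      have z'' : (2 : Fin 3) + 1 = 0 := rfl
      simp only [L, Fin.sum_univ_three, Finset.sum_apply, Pi.smul_apply, Pi.add_apply, Pi.mul_apply,
        Pi.pow_apply, smul_eq_mul, T, Df, X, dd, Pi.sub_apply, z, z', z'', z3, zero_add] at key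
      have v0 : vec a b c 0 = a := rfl
      have v1 : vec a b c 1 = b := rfl
      have v2 : vec a b c 2 = c := rfl
      rw [v0, v1, v2] at key
      rw [← key]
      simp
      ring
    have t1 : ((a : ℝ) + b + c) * (if a = 0 then 0 else ∑ w ∈ W (a - 1) b c, (Ar (1 :: w) : ℝ) ^ r)
        = K a b c * ∑ s ∈ range (r + 1), (r.choose s : ℝ) * ((a : ℝ) * ((b : ℝ) - c) ^ (r - s)
          * p s (vec a b c - Pi.single 0 1)) := by
      rcases a with _ | a
      · simp
      · rw [if_neg (by omega), Nat.add_sub_cancel, Mom_shift r a b c 1 _ (Ar1 a b c), mul_sum, mul_sum]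
        refine sum_congr rfl fun s hs => ?_
        rw [hh s hs a b c (by omega), vec1]
        linear_combination ((r.choose s : ℝ) * ((b : ℝ) - c) ^ (r - s) * p s (vec a b c)) * K1 a b c
    have t2 : ((a : ℝ) + b + c) * (if b = 0 then 0 else ∑ w ∈ W a (b - 1) c, (Ar (2 :: w) : ℝ) ^ r)
        = K a b c * ∑ s ∈ range (r + 1), (r.choose s : ℝ) * ((b : ℝ) * ((c : ℝ) - a) ^ (r - s)
          * p s (vec a b c - Pi.single 1 1)) := by
      rcases b with _ | b
      · simp
      · rw [if_neg (by omega), Nat.add_sub_cancel, Mom_shift r a b c 2 _ (Ar2 a b c), mul_sum, mul_sum]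
        refine sum_congr rfl fun s hs => ?_
        rw [hh s hs a b c (by omega), vec2]
        linear_combination ((r.choose s : ℝ) * ((c : ℝ) - a) ^ (r - s) * p s (vec a b c)) * K2 a b c
    have t3 : ((a : ℝ) + b + c) * (if c = 0 then 0 else ∑ w ∈ W a b (c - 1), (Ar (3 :: w) : ℝ) ^ r)
        = K a b c * ∑ s ∈ range (r + 1), (r.choose s : ℝ) * ((c : ℝ) * ((a : ℝ) - b) ^ (r - s)
          * p s (vec a b c - Pi.single 2 1)) := by
      rcases c with _ | c
      · simp
      · rw [if_neg (by omega), Nat.add_sub_cancel, Mom_shift r a b c 3 _ (Ar3 a b c), mul_sum, mul_sum]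
        refine sum_congr rfl fun s hs => ?_
        rw [hh s hs a b c (by omega), vec3]
        linear_combination ((r.choose s : ℝ) * ((a : ℝ) - b) ^ (r - s) * p s (vec a b c)) * K3 a b c
    have fin : ((a : ℝ) + b + c) * Mom r a b c =
        ((a : ℝ) + b + c) * (K a b c * p r (vec a b c)) := by
      rw [mul_left_comm, key2, Mom, W_sum a b c (by omega), mul_add, mul_add, t1, t2, t3,
        ← mul_add, ← mul_add, ← sum_add_distrib, ← sum_add_distrib]
      congr 1
      refine sum_congr rfl fun s _ => ?_
      ring
    exact mul_left_cancel₀ hN.ne' fin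

lemma main (r : ℕ) : r ≤ 12 → ∃ p : Fn, p - P r ∈ F (2 * r - 1) ∧
    ∀ a b c, Mom r a b c = K a b c * p (vec a b c) := by
  induction r using Nat.strong_induction_on with
  | _ r ih =>
    intro hr
    rcases Nat.eq_zero_or_pos r with rfl | h1
    · refine ⟨1, ?_, ?_⟩
      · have : P 0 = 1 := by ext x; simp [P, co]
        rw [this]; simp
      · intro a b c
        exact Mom_eq 0 (fun _ => 1) (by simp) (by simp [L_one]) (by simp) _ a b c rfl
    · have : ∀ s, ∃ p : Fn, s < r → p - P s ∈ F (2 * s - 1) ∧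
          ∀ a b c, Mom s a b c = K a b c * p (vec a b c) := by
        intro s
        by_cases hs : s < r
        · obtain ⟨p, hp⟩ := ih s hs (by omega)
          exact ⟨p, fun _ => hp⟩
        · exact ⟨0, fun h => absurd h hs⟩
      choose p hp using this
      obtain ⟨f, f1, f2, f3⟩ := step r h1 hr p (fun s hs => (hp s hs).1)
      refine ⟨f, f1, fun a b c => ?_⟩
      have := Mom_eq r (fun s => if s < r then p s else f) (by rw [zero_pow (by omega)]; simp [f2]) (by
        simp only [lt_irrefl, if_false, f3]
        refine sum_congr rfl fun s hs => ?_
        rw [if_pos (mem_range.1 hs)]) (fun s hs => by simpa [hs] using (hp s hs).2) _ a b c rfl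
      simpa using this

lemma N_diag (n : ℕ) : N (vec n n n) = 3 * n := by simp [N, X, vec]; ring
lemma El_diag (n : ℕ) (i) : El i (vec n n n) = 0 := by
  fin_cases i <;> simp [El, N, X, vec] <;> ring
lemma Sg_diag (n : ℕ) : Sg (vec n n n) = 0 := by simp [Sg, El_diag]

lemma F_lim (r : ℕ) (f : Fn) (hf : f ∈ F (2 * r - 1)) :
    Tendsto (fun n : ℕ => f (vec n n n) / (n : ℝ) ^ r) atTop (𝓝 0) := by
  induction hf using Submodule.span_induction with
  | mem f h =>
    obtain ⟨i, j, k, a, b, rfl⟩ := h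
    have hi : i < r := by omega
    have : Tendsto (fun n : ℕ => (3 ^ i * 0 ^ j * 0 ^ k : ℝ) * ((n : ℝ) ^ i / (n : ℝ) ^ r)) atTop
        (𝓝 (3 ^ i * 0 ^ j * 0 ^ k * 0)) :=
      ((tendsto_pow_div_pow_atTop_zero hi).comp tendsto_natCast_atTop_atTop).const_mul _
    rw [mul_zero] at this
    refine this.congr fun n => ?_
    simp only [Pi.mul_apply, Pi.pow_apply, N_diag, El_diag]
    ring
  | zero => simp
  | add f g _ _ hf hg =>
    have := hf.add hg
    rw [add_zero] at this
    refine this.congr fun n => ?_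
    simp [add_div]
  | smul a f _ hf =>
    have := hf.const_mul a
    rw [mul_zero] at this
    refine this.congr fun n => ?_
    simp [mul_div_assoc]

lemma P_diag (r n : ℕ) : P r (vec n n n) = co r 0 * 3 ^ r * n ^ r := by
  simp only [P, Finset.sum_apply, Pi.smul_apply, Pi.mul_apply, Pi.pow_apply, N_diag, Sg_diag,
    smul_eq_mul]
  rw [sum_eq_single 0]
  · simp; ring
  · intro q _ hq; simp [hq]
  · simp

lemma m_lim (r : ℕ) (hr : r ≤ 12) :
    Tendsto (fun n : ℕ => m r n / ((-(n : ℝ) / 2) ^ r * (n : ℝ) ^ r)) atTop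
      (𝓝 (co r 0 * 3 ^ r)) := by
  obtain ⟨p, hp, hM⟩ := main r hr
  have h := (F_lim r _ hp).add_const (co r 0 * 3 ^ r)
  rw [zero_add] at h
  refine h.congr' ?_
  filter_upwards [eventually_gt_atTop 0] with n hn
  have hn' : (n : ℝ) ≠ 0 := by positivity
  have h0 : Mom 0 n n n = K n n n := by
    have := Mom_eq 0 (fun _ => 1) (by simp) (by simp [L_one]) (by simp) _ n n n rfl
    simpa using this
  have hK := (K_pos n n n).ne'
  rw [m_eq, hM, h0, mul_div_cancel_left₀ _ hK, mul_div_mul_left _ _ (by simp [hn'])]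
  simp only [Pi.sub_apply, P_diag]
  field_simp
  ring

lemma ratio_lim (k : ℕ) (hk : 2 * k ≤ 12) :
    Tendsto (fun n => m (2 * k) n / (m 2 n) ^ k) atTop (𝓝 (co (2 * k) 0 * 3 ^ (2 * k))) := by
  have h1 := m_lim (2 * k) hk
  have h2 := (m_lim 2 (by norm_num)).pow k
  have e : co 2 0 * 3 ^ 2 = 1 := by norm_num [co]
  rw [e, one_pow] at h2
  have h3 := h1.div h2 one_ne_zero
  rw [div_one] at h3
  refine h3.congr' ?_
  filter_upwards [eventually_gt_atTop 0] with n hn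
  have hn' : (n : ℝ) ≠ 0 := by positivity
  simp only [Pi.div_apply]
  rw [div_pow (m 2 n), mul_pow _ _ k, ← pow_mul, ← pow_mul, div_div_div_cancel_right₀]
  simp [hn']

end Gp

theorem gep_words_standardized_even_moment_limits :
    Filter.Tendsto (fun n => m 6 n / (m 2 n) ^ 3) Filter.atTop (nhds (279 / 7 : ℝ))
      ∧ Filter.Tendsto (fun n => m 8 n / (m 2 n) ^ 4) Filter.atTop (nhds (3429 / 5 : ℝ))
      ∧ Filter.Tendsto (fun n => m 10 n / (m 2 n) ^ 5) Filter.atTop (nhds (206955 / 11 : ℝ))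
      ∧ Filter.Tendsto (fun n => m 12 n / (m 2 n) ^ 6) Filter.atTop
          (nhds (343717911 / 455 : ℝ)) := by
  refine ⟨?_, ?_, ?_, ?_⟩
  · convert Gp.ratio_lim 3 (by norm_num) using 2
    norm_num [Gp.co]
  · convert Gp.ratio_lim 4 (by norm_num) using 2
    norm_num [Gp.co]
  · convert Gp.ratio_lim 5 (by norm_num) using 2
    norm_num [Gp.co]
  · convert Gp.ratio_lim 6 (by norm_num) using 2
    norm_num [Gp.co]
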